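/- For every μ ≥ 1, (Real.Gamma (μ²) / Q̄_μ) · ∫_{x ∈ D_μ} (1/2) · (∑_{i ≠ j} Real.sqrt (p(x) i * p(x) j)) · (∏_{i < j} (p(x) i − p(x) j)²) dx = (1 / (2 μ²)) · ∑_{k=0}^{μ−1} ∑_{l=0}^{μ−1} ( I_{k k}^{(1/2)} · I_{l l}^{(1/2)} − (I_{k l}^{(1/2)})² ). (The left-hand side is the mean negativity ⟨N⟩ of a Haar-random pure state on a μ × μ bipartite system, averaged over the Schmidt-coefficient distribution P(p) ∝ ∏_{i<j}(p_i − p_j)² on the probability simplex.) -/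

import Mathlib

open scoped BigOperators

/-- The Laguerre polynomial `L_n`. -/
noncomputable def laguerre (n : ℕ) (x : ℝ) : ℝ :=
  ∑ k ∈ Finset.range (n + 1), (-1) ^ k * (n.choose k : ℝ) * x ^ k / (k.factorial : ℝ)

/-- `I_{kl}^{(β)} = ∫₀^∞ e^{-q} q^β L_k(q) L_l(q) dq`. -/
noncomputable def Ikl (k l : ℕ) (β : ℝ) : ℝ :=
  ∫ q in Set.Ioi (0 : ℝ), Real.exp (-q) * q ^ β * laguerre k q * laguerre l q

/-- `Q̄_μ = μ! ∏_{k=0}^{μ-1} (k!)²`. -/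
noncomputable def Qbar (μ : ℕ) : ℝ :=
  (μ.factorial : ℝ) * ∏ k ∈ Finset.range μ, ((k.factorial : ℝ)) ^ 2

/-- The simplex domain `D_μ`. -/
def Dset (μ : ℕ) : Set (Fin (μ - 1) → ℝ) :=
  {x | (∀ i, 0 < x i) ∧ ∑ i, x i < 1}

/-- Extension of `x` to the probability simplex in `Fin μ → ℝ`. -/
noncomputable def pExt (μ : ℕ) (x : Fin (μ - 1) → ℝ) : Fin μ → ℝ :=
  fun i => if h : (i : ℕ) < μ - 1 then x ⟨i, h⟩ else 1 - ∑ j, x j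


section Radial
open MeasureTheory

lemma radial_mp (n : ℕ) : MeasurePreserving
    (fun p : (Fin n → ℝ) × ℝ => (Fin.snoc p.1 (p.2 - ∑ i, p.1 i) : Fin (n+1) → ℝ))
    (volume.prod volume) volume := by
  have h1 : MeasurePreserving
      (fun p : (Fin n → ℝ) × ℝ => ((p.1, p.2 - ∑ i, p.1 i) : (Fin n → ℝ) × ℝ))
      (volume.prod volume) (volume.prod volume) := by
    refine (MeasurePreserving.id volume).skew_product
      (g := fun (y : Fin n → ℝ) (r : ℝ) => r - ∑ i, y i) (by fun_prop) ?_
    filter_upwards with y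
    exact map_sub_right_eq_self volume (∑ i, y i)
  have h2 := (volume_preserving_piFinSuccAbove (fun _ : Fin (n+1) => ℝ) (Fin.last n)).symm
  have h3 := (h2.comp (Measure.measurePreserving_swap (μ := (volume : Measure (Fin n → ℝ))) (ν := (volume : Measure ℝ)))).comp h1
  have he : (fun p : (Fin n → ℝ) × ℝ => (Fin.snoc p.1 (p.2 - ∑ i, p.1 i) : Fin (n+1) → ℝ)) =
      ((⇑(MeasurableEquiv.piFinSuccAbove (fun _ => ℝ) (Fin.last n)).symm ∘ Prod.swap) ∘
        fun p : (Fin n → ℝ) × ℝ => (p.1, p.2 - ∑ i, p.1 i)) := by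
    funext p
    simp [Function.comp, MeasurableEquiv.piFinSuccAbove]
    rfl
  rw [he]
  exact h3

lemma pExt_eq (n : ℕ) (x : Fin n → ℝ) :
    pExt (n+1) x = (Fin.snoc x (1 - ∑ j, x j) : Fin (n+1) → ℝ) := by
  funext i
  refine Fin.lastCases ?_ (fun i => ?_) i
  · simp [pExt]
  · simp [pExt]

lemma radial (n : ℕ) (f : (Fin (n+1) → ℝ) → ℝ) (d : ℕ)
    (hf : ∀ r > 0, ∀ q, (∀ i, 0 < q i) → f (r • q) = r ^ d * f q)
    (hint : Integrable (fun q => Real.exp (-∑ i, q i) * f q)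
      (volume.restrict (Set.univ.pi fun _ => Set.Ioi 0))) :
    ∫ q in Set.univ.pi (fun _ => Set.Ioi (0:ℝ)), Real.exp (-∑ i, q i) * f q
      = Real.Gamma ((d : ℝ) + n + 1) * ∫ x in Dset (n+1), f (pExt (n+1) x) := by
  change _ = Real.Gamma ((d : ℝ) + n + 1) *
    ∫ x : Fin n → ℝ in {x : Fin n → ℝ | (∀ i, 0 < x i) ∧ ∑ i, x i < 1}, f (pExt (n+1) x)
  simp_rw [pExt_eq]
  have hS : MeasurableSet (Set.univ.pi (fun _ : Fin (n+1) => Set.Ioi (0:ℝ))) :=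
    MeasurableSet.univ_pi fun _ => measurableSet_Ioi
  have hD : MeasurableSet {x : Fin n → ℝ | (∀ i, 0 < x i) ∧ ∑ i, x i < 1} := by
    measurability
  rw [← integral_indicator hS]
  replace hint := (integrable_indicator_iff hS).2 hint
  set G := (Set.univ.pi (fun _ : Fin (n+1) => Set.Ioi (0:ℝ))).indicator
    (fun q => Real.exp (-∑ i, q i) * f q) with hG
  have mp := radial_mp n
  rw [← mp.map_eq, integral_map mp.measurable.aemeasurable
    (by rw [mp.map_eq]; exact hint.aestronglyMeasurable)]
  have hint2 : Integrable (fun p : (Fin n → ℝ) × ℝ => G (Fin.snoc p.1 (p.2 - ∑ i, p.1 i)))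
      (volume.prod volume) := mp.integrable_comp_of_integrable hint
  rw [integral_prod_symm _ hint2]
  have key : ∀ r : ℝ, ∫ y : Fin n → ℝ, G (Fin.snoc y (r - ∑ i, y i)) =
      (Set.Ioi (0:ℝ)).indicator (fun r => Real.exp (-r) * r ^ ((d:ℝ) + n + 1 - 1) *
      ∫ x : Fin n → ℝ in {x : Fin n → ℝ | (∀ i, 0 < x i) ∧ ∑ i, x i < 1}, f (Fin.snoc x (1 - ∑ j, x j) : Fin (n+1) → ℝ)) r := by
    intro r
    by_cases hr : 0 < r
    · have h := Measure.integral_comp_smul (volume : Measure (Fin n → ℝ))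
        (fun y => G (Fin.snoc y (r - ∑ i, y i))) r
      have hrn : (0:ℝ) < r ^ n := by positivity
      have h' : ∫ y : Fin n → ℝ, G (Fin.snoc y (r - ∑ i, y i)) = r ^ n *
          ∫ x : Fin n → ℝ, G (Fin.snoc (r • x) (r - ∑ i, (r • x) i)) := by
        rw [h]
        simp [abs_of_pos hrn]
        field_simp
      rw [h', Set.indicator_of_mem (by exact hr), ← integral_indicator hD]
      rw [← integral_const_mul, ← integral_const_mul]
      congr 1
      funext x
      have hsn : (Fin.snoc (r • x) (r - ∑ i, (r • x) i) : Fin (n+1) → ℝ)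
          = r • (Fin.snoc x (1 - ∑ j, x j) : Fin (n+1) → ℝ) := by
        funext i
        refine Fin.lastCases ?_ (fun i => ?_) i
        · simp [← Finset.mul_sum]; ring
        · simp
      rw [hsn]
      by_cases hx : x ∈ {x : Fin n → ℝ | (∀ i, 0 < x i) ∧ ∑ i, x i < 1}
      · have hpos : ∀ i, 0 < (Fin.snoc x (1 - ∑ j, x j) : Fin (n+1) → ℝ) i := by
          intro i
          refine Fin.lastCases ?_ (fun i => ?_) i
          · simpa using hx.2
          · simpa using hx.1 i
        rw [Set.indicator_of_mem hx, hG, Set.indicator_of_mem, hf r hr _ hpos]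
        · have hsum : ∑ i, (r • (Fin.snoc x (1 - ∑ j, x j) : Fin (n+1) → ℝ)) i = r := by
            rw [Fin.sum_univ_castSucc]
            simp [← Finset.mul_sum]; ring
          rw [hsum]
          have : r ^ ((d:ℝ) + n + 1 - 1) = r ^ d * r ^ n := by
            rw [add_sub_cancel_right, ← Nat.cast_add, Real.rpow_natCast, pow_add]
          rw [this]; ring
        · intro i _
          simpa using mul_pos hr (hpos i)
      · rw [Set.indicator_of_notMem hx, hG, Set.indicator_of_notMem]
        · simp
        · intro hmem
          apply hx
          have hpos : ∀ i, 0 < (Fin.snoc x (1 - ∑ j, x j) : Fin (n+1) → ℝ) i := by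
            intro i
            have := hmem i trivial
            simp only [Pi.smul_apply, smul_eq_mul, Set.mem_Ioi] at this
            exact (mul_pos_iff_of_pos_left hr).1 this
          refine ⟨fun i => by simpa using hpos i.castSucc, by simpa using hpos (Fin.last n)⟩
    · rw [Set.indicator_of_notMem (by exact hr)]
      rw [← integral_zero (Fin n → ℝ) ℝ (μ := volume)]
      congr 1
      funext y
      rw [hG, Set.indicator_of_notMem]
      intro hmem
      have h1 : 0 < r - ∑ i, y i := by simpa using hmem (Fin.last n) trivial
      have h2 : 0 ≤ ∑ i, y i := Finset.sum_nonneg fun i _ => by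
        have : 0 < y i := by simpa using hmem i.castSucc trivial
        exact this.le
      linarith
  simp_rw [key]
  rw [integral_indicator measurableSet_Ioi, integral_mul_const, Real.Gamma_eq_integral (by positivity)]

end Radial

section Lag
open MeasureTheory

/-- Weighted monomials are integrable. -/
lemma int_mono (β : ℝ) (hβ : 0 ≤ β) (m : ℕ) :
    IntegrableOn (fun q : ℝ => Real.exp (-q) * q ^ β * q ^ m) (Set.Ioi 0) := by
  have h := Real.GammaIntegral_convergent (s := β + m + 1) (by positivity)
  refine h.congr_fun (fun q hq => ?_) measurableSet_Ioi
  have hq' : (0:ℝ) < q := hq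
  simp only
  rw [add_sub_cancel_right, Real.rpow_add hq', Real.rpow_natCast]; ring

lemma int_lag1 (β : ℝ) (hβ : 0 ≤ β) (m l : ℕ) :
    IntegrableOn (fun q : ℝ => Real.exp (-q) * q ^ β * q ^ m * laguerre l q) (Set.Ioi 0) := by
  have : (fun q : ℝ => Real.exp (-q) * q ^ β * q ^ m * laguerre l q) = fun q =>
      ∑ k ∈ Finset.range (l + 1), ((-1) ^ k * (l.choose k : ℝ) / (k.factorial : ℝ)) *
        (Real.exp (-q) * q ^ β * q ^ (m + k)) := by
    funext q
    rw [laguerre, Finset.mul_sum]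
    refine Finset.sum_congr rfl fun k _ => ?_
    rw [pow_add]; ring
  rw [this]
  exact integrable_finsetSum _ fun k _ => (int_mono β hβ (m + k)).const_mul _

lemma int_lag (β : ℝ) (hβ : 0 ≤ β) (k l : ℕ) :
    IntegrableOn (fun q : ℝ => Real.exp (-q) * q ^ β * laguerre k q * laguerre l q)
      (Set.Ioi 0) := by
  have : (fun q : ℝ => Real.exp (-q) * q ^ β * laguerre k q * laguerre l q) = fun q =>
      ∑ j ∈ Finset.range (k + 1), ((-1) ^ j * (k.choose j : ℝ) / (j.factorial : ℝ)) *
        (Real.exp (-q) * q ^ β * q ^ j * laguerre l q) := by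
    funext q
    rw [laguerre, Finset.mul_sum, Finset.sum_mul]
    refine Finset.sum_congr rfl fun k _ => ?_
    ring
  rw [this]
  exact integrable_finsetSum _ fun j _ => (int_lag1 β hβ j l).const_mul _

lemma mono_val (m : ℕ) :
    ∫ q in Set.Ioi (0:ℝ), Real.exp (-q) * q ^ (0:ℝ) * q ^ m = (m.factorial : ℝ) := by
  rw [← Real.Gamma_nat_eq_factorial, Real.Gamma_eq_integral (by positivity)]
  refine setIntegral_congr_fun measurableSet_Ioi fun q hq => ?_
  simp

lemma alt_sum (l m : ℕ) (hm : m ≤ l) :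
    ∑ j ∈ Finset.range (l + 1), (-1 : ℤ) ^ j * (l.choose j) * ((m + j).choose m) =
      if m = l then (-1) ^ l else 0 := by
  have h1 : (fwdDiff (1:ℕ))^[l] (fun x : ℕ => ((x + m).choose m : ℤ)) 0 =
      if m = l then 1 else 0 := by
    rw [fwdDiff_iter_comp_add (1:ℕ) (fun x : ℕ => (x.choose m : ℤ)) m l 0]
    obtain ⟨k, rfl⟩ := Nat.exists_eq_add_of_le hm
    have h2 := fwdDiff_iter_choose 0 m
    rw [Nat.add_comm m k, Function.iterate_add_apply]
    simp only [add_zero, Nat.choose_zero_right, Nat.cast_one] at h2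
    rw [h2]
    rcases k with _ | k
    · simp
    · rw [Function.iterate_succ_apply, fwdDiff_const]
      simp [fwdDiff_iter_eq_sum_shift]
  rw [fwdDiff_iter_eq_sum_shift] at h1
  have h3 : ∑ j ∈ Finset.range (l + 1), (-1 : ℤ) ^ j * (l.choose j) * ((m + j).choose m) =
      (-1) ^ l * (if m = l then 1 else 0) := by
    rw [← h1, Finset.mul_sum]
    refine Finset.sum_congr rfl fun j hj => ?_
    have hj' : j ≤ l := by simpa [Nat.lt_succ_iff] using hj
    obtain ⟨k, rfl⟩ := Nat.exists_eq_add_of_le hj'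
    have hk : (-1:ℤ) ^ k * (-1) ^ k = 1 := by
      rw [← mul_pow]; simp
    simp only [add_tsub_cancel_left, smul_eq_mul, mul_one, zero_add, pow_add]
    rw [Nat.add_comm m j]
    linear_combination (-(-1 : ℤ) ^ j * ((j + k).choose j) * ((j + m).choose m)) * hk
  rw [h3]; split_ifs <;> simp

lemma mono_lag (l m : ℕ) (hm : m ≤ l) :
    ∫ q in Set.Ioi (0:ℝ), Real.exp (-q) * q ^ (0:ℝ) * q ^ m * laguerre l q =
      if m = l then (-1) ^ l * (l.factorial : ℝ) else 0 := by
  have : (fun q : ℝ => Real.exp (-q) * q ^ (0:ℝ) * q ^ m * laguerre l q) = fun q =>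
      ∑ k ∈ Finset.range (l + 1), ((-1) ^ k * (l.choose k : ℝ) / (k.factorial : ℝ)) *
        (Real.exp (-q) * q ^ (0:ℝ) * q ^ (m + k)) := by
    funext q
    rw [laguerre, Finset.mul_sum]
    refine Finset.sum_congr rfl fun k _ => ?_
    rw [pow_add]; ring
  rw [this, integral_finsetSum _ fun k _ => ((int_mono 0 le_rfl (m + k)).const_mul _)]
  simp_rw [integral_const_mul, mono_val]
  have h := congrArg (fun z : ℤ => (m.factorial : ℝ) * (z : ℝ)) (alt_sum l m hm)
  simp only [Int.cast_sum, Finset.mul_sum] at h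
  push_cast at h
  have e : ∀ k ∈ Finset.range (l + 1), (-1) ^ k * (l.choose k : ℝ) / (k.factorial : ℝ) *
      ((m + k).factorial : ℝ) =
      (m.factorial : ℝ) * ((-1) ^ k * (l.choose k : ℝ) * ((m + k).choose m : ℝ)) := by
    intro k _
    have h1 : ((m + k).choose m * m.factorial * k.factorial : ℝ) = (m + k).factorial := by
      rw [Nat.choose_symm_add]
      exact_mod_cast Nat.add_choose_mul_factorial_mul_factorial m k
    rw [← h1]
    have : (k.factorial : ℝ) ≠ 0 := by positivity
    field_simp
  rw [Finset.sum_congr rfl e, h]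
  split_ifs with h
  · subst h; ring
  · simp

lemma Ikl_symm (k l : ℕ) (β : ℝ) : Ikl k l β = Ikl l k β := by
  unfold Ikl
  congr 1; funext q; ring

lemma Ikl_zero_le (k l : ℕ) (h : k ≤ l) : Ikl k l 0 = if k = l then 1 else 0 := by
  have : (fun q : ℝ => Real.exp (-q) * q ^ (0:ℝ) * laguerre k q * laguerre l q) = fun q =>
      ∑ j ∈ Finset.range (k + 1), ((-1) ^ j * (k.choose j : ℝ) / (j.factorial : ℝ)) *
        (Real.exp (-q) * q ^ (0:ℝ) * q ^ j * laguerre l q) := by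
    funext q
    rw [laguerre, Finset.mul_sum, Finset.sum_mul]
    refine Finset.sum_congr rfl fun k _ => ?_
    ring
  rw [Ikl, this, integral_finsetSum _ fun j _ => ((int_lag1 0 le_rfl j l).const_mul _)]
  simp_rw [integral_const_mul]
  rw [Finset.sum_range_succ, Finset.sum_eq_zero, mono_lag l k h]
  · split_ifs with h
    · subst h
      have : (k.factorial : ℝ) ≠ 0 := by positivity
      have h2 : (-1:ℝ) ^ k * (-1) ^ k = 1 := by rw [← mul_pow]; simp
      simp only [Nat.choose_self, Nat.cast_one]
      field_simp
      linear_combination h2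
    · simp
  · intro j hj
    have hj' := Finset.mem_range.1 hj
    rw [mono_lag l j (by omega), if_neg (by omega), mul_zero]

lemma Ikl_zero (k l : ℕ) : Ikl k l 0 = if k = l then 1 else 0 := by
  rcases le_total k l with h | h
  · exact Ikl_zero_le k l h
  · rw [Ikl_symm, Ikl_zero_le l k h]; simp [eq_comm]

end Lag

section Det
open MeasureTheory

lemma vand_sq (N : ℕ) (q : Fin N → ℝ) :
    ∏ i, ∏ j ∈ Finset.Ioi i, (q i - q j) ^ 2 =
      (∏ k ∈ Finset.range N, ((k.factorial : ℝ)) ^ 2) *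
        (Matrix.of fun (k i : Fin N) => laguerre k (q i)).det ^ 2 := by
  let U : Matrix (Fin N) (Fin N) ℝ :=
    Matrix.of fun m j => (-1) ^ (m:ℕ) * ((j:ℕ).choose m : ℝ) / ((m:ℕ).factorial : ℝ)
  have hU : U.det = ∏ k : Fin N, ((-1) ^ (k:ℕ) / ((k:ℕ).factorial : ℝ)) := by
    rw [Matrix.det_of_isUpperTriangular]
    · simp [U]
    · intro i j hij
      have : (j:ℕ) < i := hij
      simp [U, Nat.choose_eq_zero_of_lt this]
  have hM : (Matrix.of fun (k i : Fin N) => laguerre k (q i)).transpose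
      = Matrix.vandermonde q * U := by
    ext i j
    simp only [Matrix.transpose_apply, Matrix.of_apply, Matrix.mul_apply, Matrix.vandermonde_apply, U]
    rw [Fin.sum_univ_eq_sum_range (fun m => q i ^ m * ((-1) ^ m * ((j:ℕ).choose m : ℝ) / (m.factorial : ℝ))) N, laguerre]
    have hj : (j:ℕ) + 1 ≤ N := j.2
    rw [← Finset.sum_subset (Finset.range_mono hj)]
    · exact Finset.sum_congr rfl fun m _ => by ring
    · intro m _ hm
      have : (j:ℕ) < m := by simpa using hm
      simp [Nat.choose_eq_zero_of_lt this]
  rw [← Matrix.det_transpose, hM, Matrix.det_mul, mul_pow, hU, Matrix.det_vandermonde,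
    ← Fin.prod_univ_eq_prod_range (fun k => ((k.factorial : ℝ)) ^ 2) N]
  have h1 : (∏ k : Fin N, (((k:ℕ).factorial : ℝ)) ^ 2) *
      (∏ k : Fin N, ((-1) ^ (k:ℕ) / ((k:ℕ).factorial : ℝ))) ^ 2 = 1 := by
    rw [← Finset.prod_pow, ← Finset.prod_mul_distrib]
    refine Finset.prod_eq_one fun k _ => ?_
    have : ((k:ℕ).factorial : ℝ) ≠ 0 := by positivity
    have h2 : ((-1:ℝ) ^ (k:ℕ)) ^ 2 = 1 := by rw [← pow_mul, mul_comm, pow_mul]; simp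
    rw [div_pow, h2]; field_simp
  have h2 : ∏ i, ∏ j ∈ Finset.Ioi i, (q i - q j) ^ 2 =
      (∏ i, ∏ j ∈ Finset.Ioi i, (q j - q i)) ^ 2 := by
    simp_rw [← Finset.prod_pow]
    exact Finset.prod_congr rfl fun i _ => Finset.prod_congr rfl fun j _ => by ring
  rw [h2]
  linear_combination (-(∏ i, ∏ j ∈ Finset.Ioi i, (q j - q i)) ^ 2) * h1

/-- exponent at site `i` -/
noncomputable def expo {N : ℕ} (a b i : Fin N) : ℝ := if i = a ∨ i = b then 1/2 else 0

lemma expo_nonneg {N : ℕ} (a b i : Fin N) : 0 ≤ expo a b i := by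
  unfold expo; split_ifs <;> norm_num

lemma sqrt_expo {N : ℕ} (a b : Fin N) (hab : a ≠ b) (q : Fin N → ℝ) (hq : ∀ i, 0 < q i) :
    Real.sqrt (q a * q b) = ∏ i, q i ^ expo a b i := by
  rw [← Finset.prod_subset (Finset.subset_univ {a, b}), Finset.prod_pair hab]
  · simp [expo, Real.sqrt_eq_rpow, Real.mul_rpow (hq a).le (hq b).le]
  · intro i _ hi
    simp only [Finset.mem_insert, Finset.mem_singleton] at hi
    simp [expo, hi]

lemma expand {N : ℕ} (a b : Fin N) (hab : a ≠ b) (q : Fin N → ℝ) (hq : ∀ i, 0 < q i) :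
    Real.exp (-∑ i, q i) * (Real.sqrt (q a * q b) *
      (Matrix.of fun (k i : Fin N) => laguerre k (q i)).det ^ 2) =
    ∑ σ : Equiv.Perm (Fin N), ∑ τ : Equiv.Perm (Fin N),
      ((Equiv.Perm.sign σ : ℤ) : ℝ) * ((Equiv.Perm.sign τ : ℤ) : ℝ) *
      ∏ i, (Real.exp (-q i) * q i ^ expo a b i * laguerre (σ i) (q i) * laguerre (τ i) (q i)) := by
  rw [sqrt_expo a b hab q hq, pow_two, Matrix.det_apply', Finset.sum_mul_sum, Finset.mul_sum,
    Finset.mul_sum]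
  refine Finset.sum_congr rfl fun σ _ => ?_
  rw [Finset.mul_sum, Finset.mul_sum]
  refine Finset.sum_congr rfl fun τ _ => ?_
  simp only [Finset.prod_mul_distrib, Matrix.of_apply]
  rw [← Finset.sum_neg_distrib, Real.exp_sum]
  ring

lemma pi_restrict (N : ℕ) : (volume : Measure (Fin N → ℝ)).restrict
    (Set.univ.pi fun _ => Set.Ioi 0) = Measure.pi fun _ => volume.restrict (Set.Ioi 0) :=
  Measure.restrict_pi_pi _ _

lemma term_int {N : ℕ} (a b : Fin N) (σ τ : Equiv.Perm (Fin N)) :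
    Integrable (fun q : Fin N → ℝ => ∏ i, (Real.exp (-q i) * q i ^ expo a b i *
      laguerre (σ i) (q i) * laguerre (τ i) (q i)))
      (volume.restrict (Set.univ.pi fun _ => Set.Ioi 0)) := by
  rw [pi_restrict]
  exact Integrable.fintype_prod (f := fun i x => Real.exp (-x) * x ^ expo a b i *
      laguerre (σ i) x * laguerre (τ i) x) fun i => int_lag _ (expo_nonneg a b i) _ _

lemma term_val {N : ℕ} (a b : Fin N) (σ τ : Equiv.Perm (Fin N)) :
    ∫ q in (Set.univ.pi fun _ : Fin N => Set.Ioi (0:ℝ)), ∏ i, (Real.exp (-q i) * q i ^ expo a b i *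
      laguerre (σ i) (q i) * laguerre (τ i) (q i)) =
      ∏ i, Ikl (σ i) (τ i) (expo a b i) := by
  rw [pi_restrict]
  exact integral_fintype_prod_eq_prod (fun i x => Real.exp (-x) * x ^ expo a b i *
      laguerre (σ i) x * laguerre (τ i) x)

lemma orth_measurable (N : ℕ) : MeasurableSet (Set.univ.pi fun _ : Fin N => Set.Ioi (0:ℝ)) :=
  MeasurableSet.univ_pi fun _ => measurableSet_Ioi

lemma pair_int {N : ℕ} (a b : Fin N) (hab : a ≠ b) :
    Integrable (fun q : Fin N → ℝ => Real.exp (-∑ i, q i) * (Real.sqrt (q a * q b) *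
      (Matrix.of fun (k i : Fin N) => laguerre k (q i)).det ^ 2))
      (volume.restrict (Set.univ.pi fun _ => Set.Ioi 0)) := by
  refine IntegrableOn.congr_fun (f := fun q : Fin N → ℝ =>
    ∑ σ : Equiv.Perm (Fin N), ∑ τ : Equiv.Perm (Fin N),
      ((Equiv.Perm.sign σ : ℤ) : ℝ) * ((Equiv.Perm.sign τ : ℤ) : ℝ) *
      ∏ i, (Real.exp (-q i) * q i ^ expo a b i * laguerre (σ i) (q i) * laguerre (τ i) (q i)))
    ?_ (fun q hq => (expand a b hab q fun i => hq i trivial).symm) (orth_measurable N)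
  exact integrable_finsetSum _ fun σ _ => integrable_finsetSum _ fun τ _ =>
    (term_int a b σ τ).const_mul _

lemma perm_sum {N : ℕ} (a b : Fin N) (hab : a ≠ b) (σ : Equiv.Perm (Fin N)) :
    ∑ τ : Equiv.Perm (Fin N),
      ((Equiv.Perm.sign σ : ℤ) : ℝ) * ((Equiv.Perm.sign τ : ℤ) : ℝ) *
      ∏ i, Ikl (σ i) (τ i) (expo a b i) =
    Ikl (σ a) (σ a) (1/2) * Ikl (σ b) (σ b) (1/2) - Ikl (σ a) (σ b) (1/2) ^ 2 := by
  rw [← Equiv.sum_comp (Equiv.mulLeft σ)]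
  have hs : ((Equiv.Perm.sign σ : ℤ) : ℝ) * ((Equiv.Perm.sign σ : ℤ) : ℝ) = 1 := by
    rcases Int.units_eq_one_or (Equiv.Perm.sign σ) with h | h <;> simp [h]
  have hne : (1 : Equiv.Perm (Fin N)) ≠ Equiv.swap a b := by
    intro h
    have := congrArg (fun e : Equiv.Perm (Fin N) => e a) h
    simp at this
    exact hab this
  have hprod : ∀ ρ : Equiv.Perm (Fin N), (∀ i, i ≠ a → i ≠ b → ρ i = i) →
      ∏ i, Ikl (σ i) (σ (ρ i)) (expo a b i) =
        Ikl (σ a) (σ (ρ a)) (1/2) * Ikl (σ b) (σ (ρ b)) (1/2) := by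
    intro ρ hρ
    rw [← Finset.prod_subset (Finset.subset_univ {a, b}), Finset.prod_pair hab]
    · simp [expo]
    · intro i _ hi
      simp only [Finset.mem_insert, Finset.mem_singleton, not_or] at hi
      simp [expo, hi, hρ i hi.1 hi.2, Ikl_zero]
  rw [← Finset.sum_subset (Finset.subset_univ {1, Equiv.swap a b}), Finset.sum_pair hne]
  · simp only [Equiv.coe_mulLeft, Equiv.Perm.sign_mul, Equiv.Perm.mul_apply]
    rw [hprod 1 (by simp), hprod (Equiv.swap a b) (fun i h1 h2 => Equiv.swap_apply_of_ne_of_ne h1 h2)]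
    simp [Equiv.Perm.sign_swap hab]
    rw [Ikl_symm (σ b) (σ a)]
    linear_combination (Ikl (σ a) (σ a) 2⁻¹ * Ikl (σ b) (σ b) 2⁻¹ - Ikl (σ a) (σ b) 2⁻¹ ^ 2) * hs
  · intro ρ _ hρ
    simp only [Finset.mem_insert, Finset.mem_singleton, not_or] at hρ
    have hex : ∃ i, i ≠ a ∧ i ≠ b ∧ ρ i ≠ i := by
      by_contra hcon
      push Not at hcon
      have ha : ρ a = a ∨ ρ a = b := by
        by_contra h
        push Not at h
        exact h.1 (ρ.injective (hcon _ h.1 h.2))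
      have hb : ρ b = a ∨ ρ b = b := by
        by_contra h
        push Not at h
        exact h.2 (ρ.injective (hcon _ h.1 h.2))
      rcases ha with ha | ha
      · have hb' : ρ b = b := hb.resolve_left fun h => hab (ρ.injective (ha.trans h.symm))
        apply hρ.1
        ext i
        by_cases h1 : i = a
        · subst h1; simp [ha]
        · by_cases h2 : i = b
          · subst h2; simp [hb']
          · simp [hcon i h1 h2]
      · have hb' : ρ b = a := hb.resolve_right fun h => hab (ρ.injective (ha.trans h.symm))
        apply hρ.2
        ext i
        by_cases h1 : i = a
        · subst h1; simp [ha]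
        · by_cases h2 : i = b
          · subst h2; simp [hb']
          · simp [hcon i h1 h2, Equiv.swap_apply_of_ne_of_ne h1 h2]
    obtain ⟨i, h1, h2, h3⟩ := hex
    rw [Finset.prod_eq_zero (Finset.mem_univ i), mul_zero]
    have : ((σ i : Fin N) : ℕ) ≠ (σ (ρ i) : Fin N) := fun h =>
      h3 (σ.injective (Fin.ext h)).symm
    simp [expo, h1, h2, Ikl_zero, this]

lemma pair_val {N : ℕ} (a b : Fin N) (hab : a ≠ b) :
    ∫ q in (Set.univ.pi fun _ : Fin N => Set.Ioi (0:ℝ)),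
      Real.exp (-∑ i, q i) * (Real.sqrt (q a * q b) *
      (Matrix.of fun (k i : Fin N) => laguerre k (q i)).det ^ 2) =
    ∑ σ : Equiv.Perm (Fin N),
      (Ikl (σ a) (σ a) (1/2) * Ikl (σ b) (σ b) (1/2) - Ikl (σ a) (σ b) (1/2) ^ 2) := by
  rw [setIntegral_congr_fun (orth_measurable N) fun q hq => expand a b hab q fun i => hq i trivial]
  rw [integral_finsetSum _ fun σ _ => integrable_finsetSum _ fun τ _ =>
    (term_int a b σ τ).const_mul _]
  refine Finset.sum_congr rfl fun σ _ => ?_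
  rw [integral_finsetSum _ fun τ _ => (term_int a b σ τ).const_mul _, ← perm_sum a b hab σ]
  refine Finset.sum_congr rfl fun τ _ => ?_
  rw [integral_const_mul, term_val]

lemma pairs_sum (N : ℕ) :
    ∑ ij ∈ Finset.univ.filter (fun ij : Fin N × Fin N => ij.1 ≠ ij.2),
      ∑ σ : Equiv.Perm (Fin N), (Ikl (σ ij.1) (σ ij.1) (1/2) * Ikl (σ ij.2) (σ ij.2) (1/2) -
        Ikl (σ ij.1) (σ ij.2) (1/2) ^ 2) =
    (N.factorial : ℝ) * ∑ k ∈ Finset.range N, ∑ l ∈ Finset.range N,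
          (Ikl k k (1/2) * Ikl l l (1/2) - (Ikl k l (1/2)) ^ 2) := by
  let F : Fin N → Fin N → ℝ := fun k l => Ikl k k (1/2) * Ikl l l (1/2) - (Ikl k l (1/2)) ^ 2
  have hF : ∀ k, F k k = 0 := fun k => by simp only [F]; ring
  change ∑ ij ∈ Finset.univ.filter (fun ij : Fin N × Fin N => ij.1 ≠ ij.2),
      ∑ σ : Equiv.Perm (Fin N), F (σ ij.1) (σ ij.2) = _
  rw [Finset.sum_filter_of_ne, Finset.sum_comm]
  · have h : ∀ σ : Equiv.Perm (Fin N), ∑ ij : Fin N × Fin N, F (σ ij.1) (σ ij.2) =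
        ∑ k, ∑ l, F k l := by
      intro σ
      rw [Fintype.sum_prod_type, ← Equiv.sum_comp σ (fun k => ∑ l, F k l)]
      refine Finset.sum_congr rfl fun k _ => ?_
      exact Equiv.sum_comp σ (fun l => F (σ k) l)
    simp_rw [h]
    rw [Finset.sum_const, Finset.card_univ, Fintype.card_perm, Fintype.card_fin, nsmul_eq_mul]
    congr 1
    rw [← Fin.sum_univ_eq_sum_range (fun k => ∑ l ∈ Finset.range N,
          (Ikl k k (1/2) * Ikl l l (1/2) - (Ikl k l (1/2)) ^ 2)) N]
    refine Finset.sum_congr rfl fun k _ => ?_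
    exact Fin.sum_univ_eq_sum_range (fun l =>
          (Ikl k k (1/2) * Ikl l l (1/2) - (Ikl k l (1/2)) ^ 2)) N
  · rintro ⟨i, j⟩ _ h heq
    apply h
    simp only at heq
    subst heq
    simp [hF]

end Det

theorem mean_negativity_formula (μ : ℕ) (hμ : 1 ≤ μ) :
    (Real.Gamma ((μ : ℝ) ^ 2) / Qbar μ) *
      ∫ x in Dset μ,
        (1 / 2) *
          (∑ ij ∈ Finset.univ.filter (fun ij : Fin μ × Fin μ => ij.1 ≠ ij.2),
            Real.sqrt (pExt μ x ij.1 * pExt μ x ij.2)) *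
          (∏ i, ∏ j ∈ Finset.Ioi i, (pExt μ x i - pExt μ x j) ^ 2)
      = (1 / (2 * (μ : ℝ) ^ 2)) *
        ∑ k ∈ Finset.range μ, ∑ l ∈ Finset.range μ,
          (Ikl k k (1/2) * Ikl l l (1/2) - (Ikl k l (1/2)) ^ 2) := by
  obtain ⟨n, rfl⟩ : ∃ n, μ = n + 1 := ⟨μ - 1, by omega⟩
  let S : Set (Fin (n+1) → ℝ) := Set.univ.pi fun _ => Set.Ioi 0
  let f : (Fin (n+1) → ℝ) → ℝ := fun q => (1 / 2) *
          (∑ ij ∈ Finset.univ.filter (fun ij : Fin (n+1) × Fin (n+1) => ij.1 ≠ ij.2),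
            Real.sqrt (q ij.1 * q ij.2)) *
          (∏ i, ∏ j ∈ Finset.Ioi i, (q i - q j) ^ 2)
  let c : ℝ := ∏ k ∈ Finset.range (n+1), ((k.factorial : ℝ)) ^ 2
  have hc : c ≠ 0 := Finset.prod_ne_zero_iff.2 fun k _ => by positivity
  have hfe : (fun q : Fin (n+1) → ℝ => Real.exp (-∑ i, q i) * f q) = fun q =>
      ∑ ij ∈ Finset.univ.filter (fun ij : Fin (n+1) × Fin (n+1) => ij.1 ≠ ij.2),
        (1 / 2 * c) * (Real.exp (-∑ i, q i) * (Real.sqrt (q ij.1 * q ij.2) *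
      (Matrix.of fun (k i : Fin (n+1)) => laguerre k (q i)).det ^ 2)) := by
    funext q
    simp only [f]
    rw [vand_sq, ← Finset.mul_sum, ← Finset.mul_sum, ← Finset.sum_mul]
    ring
  have hterm : ∀ ij ∈ Finset.univ.filter (fun ij : Fin (n+1) × Fin (n+1) => ij.1 ≠ ij.2),
      MeasureTheory.Integrable (fun q : Fin (n+1) → ℝ =>
        (1 / 2 * c) * (Real.exp (-∑ i, q i) * (Real.sqrt (q ij.1 * q ij.2) *
      (Matrix.of fun (k i : Fin (n+1)) => laguerre k (q i)).det ^ 2)))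
      (MeasureTheory.volume.restrict (Set.univ.pi fun _ => Set.Ioi 0)) := fun ij hij =>
    (pair_int ij.1 ij.2 (Finset.mem_filter.1 hij).2).const_mul _
  have hrad := radial n f (1 + n * (n + 1)) (by
    intro r hr q hq
    have h1 : ∀ ij : Fin (n+1) × Fin (n+1), Real.sqrt ((r • q) ij.1 * (r • q) ij.2) =
        r * Real.sqrt (q ij.1 * q ij.2) := by
      intro ij
      have : (r • q) ij.1 * (r • q) ij.2 = r ^ 2 * (q ij.1 * q ij.2) := by
        simp only [Pi.smul_apply, smul_eq_mul]; ring
      rw [this, Real.sqrt_mul (by positivity), Real.sqrt_sq hr.le]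
    have h2 : ∏ i, ∏ j ∈ Finset.Ioi i, ((r • q) i - (r • q) j) ^ 2 =
        r ^ (n * (n + 1)) * ∏ i, ∏ j ∈ Finset.Ioi i, (q i - q j) ^ 2 := by
      have e : ∀ i j, ((r • q) i - (r • q) j) ^ 2 = r ^ 2 * (q i - q j) ^ 2 := by
        intro i j
        simp only [Pi.smul_apply, smul_eq_mul]; ring
      simp_rw [e, Finset.prod_mul_distrib, Finset.prod_const, Fin.card_Ioi, ← pow_mul]
      rw [Finset.prod_pow_eq_pow_sum, ← Finset.mul_sum]
      congr 2
      rw [Fin.sum_univ_eq_sum_range (fun i => n + 1 - 1 - i) (n+1),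
        Finset.sum_range_reflect (fun i => i) (n+1), mul_comm, Finset.sum_range_id_mul_two]
      simp [mul_comm]
    simp only [f]
    rw [h2, Finset.sum_congr rfl fun ij _ => h1 ij, ← Finset.mul_sum, pow_add, pow_one]
    ring) (by
    rw [hfe]
    exact MeasureTheory.integrable_finsetSum _ hterm)
  rw [hfe, MeasureTheory.integral_finsetSum _ hterm] at hrad
  simp_rw [MeasureTheory.integral_const_mul] at hrad
  rw [← Finset.mul_sum, Finset.sum_congr rfl fun ij hij =>
    pair_val ij.1 ij.2 (Finset.mem_filter.1 hij).2, pairs_sum] at hrad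
  have hG : Real.Gamma (((1 + n * (n + 1) : ℕ) : ℝ) + n + 1) =
      (((n + 1 : ℕ) : ℝ)) ^ 2 * Real.Gamma ((((n + 1 : ℕ) : ℝ)) ^ 2) := by
    rw [← Real.Gamma_add_one (by positivity)]
    congr 1
    push_cast; ring
  rw [hG] at hrad
  change Real.Gamma ((((n + 1 : ℕ) : ℝ)) ^ 2) / Qbar (n+1) *
    (∫ x in Dset (n+1), f (pExt (n+1) x)) = _
  have hQ : Qbar (n+1) = ((n+1).factorial : ℝ) * c := rfl
  rw [hQ]
  generalize (∫ x in Dset (n+1), f (pExt (n+1) x)) = A at *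
  have hfac : ((n+1).factorial : ℝ) ≠ 0 := by positivity
  have hN : ((n + 1 : ℕ) : ℝ) ≠ 0 := by positivity
  rw [div_mul_eq_mul_div, div_eq_iff (mul_ne_zero hfac hc)]
  rw [one_div, inv_mul_eq_div, div_mul_eq_mul_div, eq_div_iff (by positivity)]
  linear_combination (-2) * hrad
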